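/- Let K be an imaginary quadratic field, p a rational prime split in K, and O an order of K with p not dividing the conductor. Then the norm map N : O → Z is surjective onto Z/p^kZ after reduction: for every a ∈ Z/p^kZ there exists λ ∈ O with N(λ) ≡ a (mod p^k). -/

import Mathlib

/-!
STATEMENT 15: Let `K` be an imaginary quadratic field, `p` a rational prime split in `K`,
and `O` an order of `K` with `p` not dividing the conductor, so that
`pO = 𝔭·𝔭̄` with `𝔭 ≠ 𝔭̄` distinct conjugate prime ideals of `O`.  Then the norm map
`N : O → ℤ` is surjective onto `ℤ/p^kℤ` after reduction: for every `a ∈ ℤ/p^kℤ` there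
exists `λ ∈ O` with `N(λ) ≡ a (mod p^k)`.

We model `O = ℤ[τ]`, `τ` a root of `X² - tX + n` with `t² - 4n < 0`; conjugation is the
ring endomorphism `conj` with `conj τ = t - τ`, and the splitting hypothesis is
`pO = 𝔭 · conj(𝔭)` with `𝔭` and `conj(𝔭)` distinct primes.  `λ = u + vτ` has norm
`N(λ) = u² + t·u·v + n·v²`.
-/

open Polynomial

/-- The imaginary quadratic order `O = ℤ[τ]`, `τ` a root of `X² - tX + n`. -/
abbrev Oord (t n : ℤ) := AdjoinRoot (X ^ 2 - C t * X + C n : ℤ[X])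

/-- The generator `τ` of the order. -/
noncomputable def tau (t n : ℤ) : Oord t n := AdjoinRoot.root _

theorem exists_eq_add_mul_tau (t n : ℤ) (x : Oord t n) :
    ∃ a b : ℤ, x = (a : Oord t n) + b * tau t n := by
  have hf : (X ^ 2 - C t * X + C n : ℤ[X]).Monic := by monicity!
  have hdeg : (X ^ 2 - C t * X + C n : ℤ[X]).natDegree = 2 := by compute_degree!
  obtain ⟨q, rfl⟩ := AdjoinRoot.mk_surjective x
  have hlt := natDegree_modByMonic_lt q hf (fun h => by rw [h, natDegree_one] at hdeg; omega)
  obtain ⟨b, a, hab⟩ := exists_eq_X_add_C_of_natDegree_le_one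
    (show (q %ₘ (X ^ 2 - C t * X + C n)).natDegree ≤ 1 by omega)
  refine ⟨a, b, ?_⟩
  have hq := congrArg (AdjoinRoot.mk (X ^ 2 - C t * X + C n : ℤ[X]))
    (modByMonic_add_div q (X ^ 2 - C t * X + C n))
  rw [map_add, map_mul, AdjoinRoot.mk_self, zero_mul, add_zero, hab] at hq
  rw [← hq]
  simp [tau, add_comm]

theorem mem_right_of_span_singleton_eq_mul {R : Type*} [CommRing R] {x : R} {I J : Ideal R}
    (h : Ideal.span {x} = I * J) : x ∈ J := by
  have hle : I * J ≤ J := Ideal.mul_le_right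
  rw [← h, Ideal.span_singleton_le_iff_mem] at hle
  exact hle

theorem tau_sq (t n : ℤ) : tau t n ^ 2 = t * tau t n - n := by
  have h := AdjoinRoot.mk_self (f := (X ^ 2 - C t * X + C n : ℤ[X]))
  simp only [map_add, map_sub, map_mul, map_pow, AdjoinRoot.mk_X, eq_intCast, map_intCast] at h
  rw [tau]
  linear_combination h

theorem dvd_of_intCast_mem_span (t n : ℤ) (p : ℕ) (hp : p.Prime) (m : ℤ)
    (h : (m : Oord t n) ∈ Ideal.span {(p : Oord t n)}) : (p : ℤ) ∣ m := by
  have : Fact p.Prime := ⟨hp⟩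
  obtain ⟨y, hy⟩ := Ideal.mem_span_singleton.mp h
  obtain ⟨q, rfl⟩ := AdjoinRoot.mk_surjective y
  have hdvd : (X ^ 2 - C t * X + C n : ℤ[X]) ∣ (m : ℤ[X]) - (p : ℤ[X]) * q := by
    rw [← AdjoinRoot.mk_eq_zero, map_sub, map_mul, map_intCast, map_natCast, hy, sub_self]
  have hmap := Polynomial.map_dvd (Int.castRingHom (ZMod p)) hdvd
  have hf : (X ^ 2 - C (t : ZMod p) * X + C (n : ZMod p)).Monic := by monicity!
  have hdeg : (X ^ 2 - C (t : ZMod p) * X + C (n : ZMod p)).natDegree = 2 := by compute_degree!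
  have hmap' : (X ^ 2 - C (t : ZMod p) * X + C (n : ZMod p)) ∣ C (m : ZMod p) := by
    have hp0 : ((p : ℕ) : (ZMod p)[X]) = 0 := by
      rw [← C_eq_natCast, ZMod.natCast_self, C_0]
    simpa [hp0] using hmap
  by_contra hm
  refine hf.not_dvd_of_natDegree_lt ?_ ?_ hmap'
  · rwa [Ne, C_eq_zero, ZMod.intCast_zmod_eq_zero_iff_dvd]
  · rw [natDegree_C, hdeg]; norm_num

/-- A quadratic `A X² + B X` with `p ∣ A` and `p ∤ B` permutes `ℤ/p^k`. -/
theorem exists_quadratic_eq (p : ℕ) (hp : p.Prime) (k : ℕ) (A B : ℤ)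
    (hA : (p : ℤ) ∣ A) (hB : ¬ (p : ℤ) ∣ B) (c : ZMod (p ^ k)) :
    ∃ β : ℤ, ((A * β ^ 2 + B * β : ℤ) : ZMod (p ^ k)) = c := by
  have : NeZero (p ^ k) := ⟨pow_ne_zero _ hp.ne_zero⟩
  have hunit (m : ℤ) : IsUnit ((A * m + B : ℤ) : ZMod (p ^ k)) := by
    rw [ZMod.coe_int_isUnit_iff_isCoprime]
    push_cast
    refine IsCoprime.pow_left ((Nat.prime_iff_prime_int.mp hp).coprime_iff_not_dvd.mpr ?_)
    rwa [dvd_add_right (hA.mul_right m)]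
  have hinj : Function.Injective
      (fun x : ZMod (p ^ k) => (A : ZMod (p ^ k)) * x ^ 2 + B * x) := by
    intro x y hxy
    obtain ⟨x, rfl⟩ := ZMod.intCast_surjective x
    obtain ⟨y, rfl⟩ := ZMod.intCast_surjective y
    rw [← sub_eq_zero, ← (hunit (x + y)).mul_right_eq_zero]
    push_cast
    linear_combination hxy
  obtain ⟨x, hx⟩ := Finite.surjective_of_injective hinj c
  obtain ⟨β, rfl⟩ := ZMod.intCast_surjective x
  exact ⟨β, by push_cast; exact hx⟩

theorem norm_surjective_mod_split_prime_power (t n : ℤ) (himag : t ^ 2 - 4 * n < 0)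
    (p : ℕ) (hp : p.Prime)
    (conj : Oord t n →+* Oord t n) (hconj : conj (tau t n) = (t : Oord t n) - tau t n)
    (P : Ideal (Oord t n)) (hP : P.IsPrime) (hPbar : (Ideal.map conj P).IsPrime)
    (hfac : Ideal.span {(p : Oord t n)} = P * Ideal.map conj P)
    (hne : P ≠ Ideal.map conj P)
    (k : ℕ) (hk : 0 < k) (a : ZMod (p ^ k)) :
    ∃ u v : ℤ, ((u ^ 2 + t * u * v + n * v ^ 2 : ℤ) : ZMod (p ^ k)) = a := by
  have hconj' (a b : ℤ) : conj (a + b * tau t n) = a + b * (t - tau t n) := by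
    simp [hconj]
  have hinv : conj.comp conj = RingHom.id _ := by
    refine RingHom.ext fun x => ?_
    obtain ⟨a, b, rfl⟩ := exists_eq_add_mul_tau t n x
    simp [hconj]
  have hnle : ¬ P ≤ Ideal.map conj P := by
    intro hle
    refine hne (le_antisymm hle ?_)
    have := Ideal.map_mono (f := conj) hle
    rwa [Ideal.map_map, hinv, Ideal.map_id] at this
  obtain ⟨x, hxP, hxPbar⟩ := SetLike.not_le_iff_exists.mp hnle
  have hcx := Ideal.mem_map_of_mem conj hxP
  have hmul := Ideal.mul_mem_mul hxP hcx
  rw [← hfac] at hmul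
  obtain ⟨a₀, b₀, rfl⟩ := exists_eq_add_mul_tau t n x
  rw [hconj'] at hcx hmul
  have hN : (p : ℤ) ∣ a₀ ^ 2 + t * a₀ * b₀ + n * b₀ ^ 2 := by
    refine dvd_of_intCast_mem_span t n p hp _ ?_
    convert hmul using 1
    push_cast
    linear_combination (b₀ : Oord t n) ^ 2 * tau_sq t n
  have hT : ¬ (p : ℤ) ∣ 2 * a₀ + t * b₀ := by
    rintro ⟨m, hm⟩
    have hmem : ((p : Oord t n)) ∈ Ideal.map conj P :=
      mem_right_of_span_singleton_eq_mul hfac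
    refine hxPbar ?_
    have hm' := congrArg (Int.cast : ℤ → Oord t n) hm
    push_cast at hm'
    have hx : (a₀ : Oord t n) + b₀ * tau t n = p * m - (a₀ + b₀ * (t - tau t n)) := by
      linear_combination hm'
    rw [hx]
    exact sub_mem (Ideal.mul_mem_right _ _ hmem) hcx
  set N := a₀ ^ 2 + t * a₀ * b₀ + n * b₀ ^ 2 with hNdef
  have hB : ¬ (p : ℤ) ∣ (2 * a₀ + t * b₀) ^ 2 - 2 * N := by
    rw [dvd_sub_left (hN.mul_left 2)]
    exact fun h => hT ((Nat.prime_iff_prime_int.mp hp).dvd_of_dvd_pow h)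
  obtain ⟨β, hβ⟩ := exists_quadratic_eq p hp k N _ hN hB (a - (N : ZMod (p ^ k)))
  refine ⟨a₀ + β * (a₀ + t * b₀), b₀ * (1 - β), ?_⟩
  rw [eq_sub_iff_add_eq, ← Int.cast_add] at hβ
  rw [← hβ]
  congr 1
  rw [hNdef]
  ring
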